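/- Let R be an integral domain of characteristic zero and 𝔲 a set of derivations of R, with filtration G_i = {x ∈ R : every composite D_{i+1} ∘ ⋯ ∘ D_1 of i+1 derivations from 𝔲 annihilates x} for i ≥ 0, and assume that every element of R lies in some G_i. For x ≠ 0 let ι(x) be the least i ≥ 0 with x ∈ G_i. If x, x', y, y' ∈ R are nonzero and x·y' = x'·y, then ι(x) + ι(y') = ι(x') + ι(y); consequently the value −ι(x) + ι(y) depends only on the fraction x/y in the fraction field of R. -/

import Mathlib

/-- Apply a list of operators to an element, the head of the list being applied first. -/
def iterApp {R : Type*} : List (R → R) → R → R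
  | [], x => x
  | D :: Ds, x => iterApp Ds (D x)

/-- A derivation of a commutative ring: an additive map satisfying the Leibniz rule. -/
def IsDerivation {R : Type*} [CommRing R] (D : R → R) : Prop :=
  (∀ a b : R, D (a + b) = D a + D b) ∧ (∀ a b : R, D (a * b) = D a * b + a * D b)

/-- For `i ≥ 0`, the `i`-th Socle piece: elements annihilated by every composite of
`i + 1` derivations from `u`. -/
def SocleGNat {R : Type*} [CommRing R] (u : Set (R → R)) (i : ℕ) : Set R :=
  {x | ∀ Ds : List (R → R), (∀ D ∈ Ds, D ∈ u) → Ds.length = i + 1 → iterApp Ds x = 0}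

/-- `iota u x` is the least `i ≥ 0` with `x ∈ G i`. -/
noncomputable def iota {R : Type*} [CommRing R] (u : Set (R → R)) (x : R) : ℕ :=
  sInf {i : ℕ | x ∈ SocleGNat u i}

theorem iterApp_zero {R : Type*} [CommRing R] {u : Set (R → R)} (hu : ∀ D ∈ u, IsDerivation D)
    (w : List (R → R)) (hw : ∀ D ∈ w, D ∈ u) : iterApp w (0 : R) = 0 := by
  induction w with
  | nil => rfl
  | cons D w ih =>
    have hD : D 0 = 0 := by simpa using (hu D (hw D (by simp))).1 0 0
    simpa [iterApp, hD] using ih fun E hE => hw E (by simp [hE])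

theorem iterApp_add {R : Type*} [CommRing R] {u : Set (R → R)} (hu : ∀ D ∈ u, IsDerivation D)
    (w : List (R → R)) (hw : ∀ D ∈ w, D ∈ u) (x y : R) :
    iterApp w (x + y) = iterApp w x + iterApp w y := by
  induction w generalizing x y with
  | nil => rfl
  | cons D w ih =>
    simpa [iterApp, (hu D (hw D (by simp))).1] using
      ih (fun E hE => hw E (by simp [hE])) (D x) (D y)

theorem iterApp_append {R : Type*} (v w : List (R → R)) (x : R) :
    iterApp (v ++ w) x = iterApp w (iterApp v x) := by
  induction v generalizing x with
  | nil => rfl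
  | cons D v ih => exact ih (D x)

/-- All ways, with multiplicity, of splitting a word into a subword and its complement;
equivalently, the pairs of words of which the given word is a shuffle. -/
def unshuffles {α : Type*} : List α → List (List α × List α)
  | [] => [([], [])]
  | a :: w => (unshuffles w).map (fun p => (a :: p.1, p.2)) ++
      (unshuffles w).map (fun p => (p.1, a :: p.2))

theorem mem_unshuffles_cons {α : Type*} {a : α} {w s t : List α} :
    (s, t) ∈ unshuffles (a :: w) ↔
      (∃ s', s = a :: s' ∧ (s', t) ∈ unshuffles w) ∨
        ∃ t', t = a :: t' ∧ (s, t') ∈ unshuffles w := by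
  simp only [unshuffles, List.mem_append, List.mem_map, Prod.exists, Prod.mk.injEq]
  grind

theorem append_mem_unshuffles {α : Type*} (s t : List α) : (s, t) ∈ unshuffles (s ++ t) := by
  induction s with
  | nil =>
    induction t with
    | nil => simp [unshuffles]
    | cons a t ih => exact mem_unshuffles_cons.2 (.inr ⟨t, rfl, ih⟩)
  | cons a s ih => exact mem_unshuffles_cons.2 (.inl ⟨s, rfl, ih⟩)

theorem perm_of_mem_unshuffles {α : Type*} {w s t : List α} (h : (s, t) ∈ unshuffles w) :
    (s ++ t).Perm w := by
  induction w generalizing s t with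
  | nil => simp_all [unshuffles]
  | cons a w ih =>
    obtain ⟨s', rfl, h'⟩ | ⟨t', rfl, h'⟩ := mem_unshuffles_cons.1 h
    · exact (ih h').cons a
    · exact List.perm_middle.trans ((ih h').cons a)

/-- The Leibniz rule for a composite of derivations. -/
theorem iterApp_mul {R : Type*} [CommRing R] {u : Set (R → R)} (hu : ∀ D ∈ u, IsDerivation D)
    (w : List (R → R)) (hw : ∀ D ∈ w, D ∈ u) (x y : R) :
    iterApp w (x * y) =
      ((unshuffles w).map fun p => iterApp p.1 x * iterApp p.2 y).sum := by
  induction w generalizing x y with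
  | nil => simp [unshuffles, iterApp]
  | cons D w ih =>
    have hw' : ∀ E ∈ w, E ∈ u := fun E hE => hw E (by simp [hE])
    simp only [iterApp, (hu D (hw D (by simp))).2, iterApp_add hu w hw', ih hw', unshuffles,
      List.map_append, List.sum_append, List.map_map, Function.comp_def]

/-- Shuffling along a fixed pattern is strictly monotone for the lexicographic order, in the
sense that lowering the factors yields a lower shuffle. -/
theorem exists_lex_of_mem_unshuffles {α : Type*} {r : α → α → Prop} {w s t s' t' : List α}
    (h : (s', t') ∈ unshuffles w) (hs : s.length = s'.length) (ht : t.length = t'.length)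
    (hss : s = s' ∨ List.Lex r s s') (htt : t = t' ∨ List.Lex r t t') :
    ∃ w', (s, t) ∈ unshuffles w' ∧ (s = s' ∧ t = t' ∨ List.Lex r w' w) := by
  induction w generalizing s t s' t' with
  | nil =>
    simp only [unshuffles, List.mem_singleton, Prod.mk.injEq] at h
    obtain ⟨rfl, rfl⟩ := h
    exact ⟨[], by simp_all [unshuffles]⟩
  | cons a w ih =>
    obtain ⟨s₀, rfl, h'⟩ | ⟨t₀, rfl, h'⟩ := mem_unshuffles_cons.1 h
    · obtain _ | ⟨b, s₁⟩ := s
      · simp at hs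
      have hlen : s₁.length = s₀.length := by simpa using hs
      by_cases hba : b = a ∧ (s₁ = s₀ ∨ List.Lex r s₁ s₀)
      · obtain ⟨rfl, hl⟩ := hba
        obtain ⟨w', hw', hlt⟩ := ih h' hlen ht hl htt
        exact ⟨b :: w', mem_unshuffles_cons.2 (.inl ⟨s₁, rfl, hw'⟩),
          hlt.imp (fun e => ⟨by rw [e.1], e.2⟩) .cons⟩
      · refine ⟨b :: (s₁ ++ t), append_mem_unshuffles (b :: s₁) t, .inr (.rel ?_)⟩
        obtain he | hl := hss
        · simp_all
        · cases hl <;> simp_all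
    · obtain _ | ⟨b, t₁⟩ := t
      · simp at ht
      have hlen : t₁.length = t₀.length := by simpa using ht
      by_cases hba : b = a ∧ (t₁ = t₀ ∨ List.Lex r t₁ t₀)
      · obtain ⟨rfl, hl⟩ := hba
        obtain ⟨w', hw', hlt⟩ := ih h' hs hlen hss hl
        exact ⟨b :: w', mem_unshuffles_cons.2 (.inr ⟨t₁, rfl, hw'⟩),
          hlt.imp (fun e => ⟨e.1, by rw [e.2]⟩) .cons⟩
      · refine ⟨b :: (s ++ t₁), mem_unshuffles_cons.2 (.inr ⟨t₁, rfl, append_mem_unshuffles s t₁⟩),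
          .inr (.rel ?_)⟩
        obtain he | hl := htt
        · simp_all
        · cases hl <;> simp_all

/-- A nonempty set of words of a fixed length has a lexicographically least element with respect
to a well-order of the letters. -/
theorem exists_lex_minimal {α : Type*} (r : α → α → Prop) [IsWellOrder α r] {n : ℕ}
    {P : List α → Prop} (hlen : ∀ w, P w → w.length = n) (hP : ∃ w, P w) :
    ∃ w, P w ∧ ∀ w', P w' → w = w' ∨ List.Lex r w w' := by
  obtain ⟨w, hw, hmin⟩ := (List.Shortlex.wf (r := r) IsWellFounded.wf).has_min {w | P w} hP
  refine ⟨w, hw, fun w' hw' => ?_⟩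
  have hnot : ¬ List.Lex r w' w := fun hl =>
    hmin w' hw' (List.Shortlex.of_lex (by rw [hlen w hw, hlen w' hw']) hl)
  obtain hl | he | hl := trichotomous_of (List.Lex r) w w'
  · exact .inr hl
  · exact .inl he
  · exact absurd hl hnot

theorem iterApp_eq_zero_of_iota_lt {R : Type*} [CommRing R] {u : Set (R → R)}
    (hu : ∀ D ∈ u, IsDerivation D) {x : R} (hx : ∃ i, x ∈ SocleGNat u i)
    {w : List (R → R)} (hw : ∀ D ∈ w, D ∈ u) (hlt : iota u x < w.length) :
    iterApp w x = 0 := by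
  have hmem : x ∈ SocleGNat u (iota u x) := Nat.sInf_mem hx
  rw [← List.take_append_drop (iota u x + 1) w, iterApp_append,
    hmem _ (fun D hD => hw D (List.mem_of_mem_take hD)) (by simp; omega)]
  exact iterApp_zero hu _ fun D hD => hw D (List.mem_of_mem_drop hD)

theorem exists_iterApp_ne_zero {R : Type*} [CommRing R] {u : Set (R → R)} {x : R} (hx : x ≠ 0) :
    ∃ w : List (R → R), (∀ D ∈ w, D ∈ u) ∧ w.length = iota u x ∧ iterApp w x ≠ 0 := by
  obtain h0 | ⟨k, hk⟩ : iota u x = 0 ∨ ∃ k, iota u x = k + 1 := by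
    cases iota u x <;> simp
  · exact ⟨[], by simp, by simp [h0], hx⟩
  · have hnot : x ∉ SocleGNat u k := Nat.notMem_of_lt_sInf (by change k < iota u x; omega)
    simp only [SocleGNat, Set.mem_ofPred_eq, not_forall] at hnot
    obtain ⟨w, hw, hlen, hne⟩ := hnot
    exact ⟨w, hw, by omega, hne⟩

theorem exists_iterApp_mul_ne_zero {R : Type*} [CommRing R] [IsDomain R] [CharZero R]
    {u : Set (R → R)} (hu : ∀ D ∈ u, IsDerivation D) (hexh : ∀ x : R, ∃ i : ℕ, x ∈ SocleGNat u i)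
    {x y : R} (hx : x ≠ 0) (hy : y ≠ 0) :
    ∃ w : List (R → R), (∀ D ∈ w, D ∈ u) ∧ w.length = iota u x + iota u y ∧
      iterApp w (x * y) ≠ 0 := by
  classical
  obtain ⟨s, ⟨hsu, hsn, hsx⟩, hsmin⟩ := exists_lex_minimal WellOrderingRel
    (fun _ h => h.2.1) (exists_iterApp_ne_zero (u := u) hx)
  obtain ⟨t, ⟨htu, htn, hty⟩, htmin⟩ := exists_lex_minimal WellOrderingRel
    (fun _ h => h.2.1) (exists_iterApp_ne_zero (u := u) hy)
  obtain ⟨w, hw, hwmin⟩ := exists_lex_minimal WellOrderingRel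
    (P := fun w => (s, t) ∈ unshuffles w) (n := (s ++ t).length)
    (fun _ h => (perm_of_mem_unshuffles h).length_eq.symm) ⟨_, append_mem_unshuffles s t⟩
  have hwu : ∀ D ∈ w, D ∈ u := fun D hD =>
    (List.mem_append.1 ((perm_of_mem_unshuffles hw).mem_iff.2 hD)).elim (hsu D) (htu D)
  have hwlen : w.length = iota u x + iota u y := by
    rw [← (perm_of_mem_unshuffles hw).length_eq, List.length_append, hsn, htn]
  refine ⟨w, hwu, hwlen, ?_⟩
  have hvanish : ∀ p, p ≠ (s, t) → p ∈ unshuffles w → iterApp p.1 x * iterApp p.2 y = 0 := by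
    rintro ⟨s', t'⟩ hne hp
    by_contra hprod
    obtain ⟨hs'x, ht'y⟩ := mul_ne_zero_iff.1 hprod
    have hperm := perm_of_mem_unshuffles hp
    have hs'u : ∀ D ∈ s', D ∈ u := fun D hD => hwu D (hperm.mem_iff.1 (by simp [hD]))
    have ht'u : ∀ D ∈ t', D ∈ u := fun D hD => hwu D (hperm.mem_iff.1 (by simp [hD]))
    have hs'le : s'.length ≤ iota u x :=
      not_lt.1 fun hlt => hs'x (iterApp_eq_zero_of_iota_lt hu (hexh x) hs'u hlt)
    have ht'le : t'.length ≤ iota u y :=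
      not_lt.1 fun hlt => ht'y (iterApp_eq_zero_of_iota_lt hu (hexh y) ht'u hlt)
    have hlen : s'.length + t'.length = iota u x + iota u y := by
      rw [← List.length_append, hperm.length_eq, hwlen]
    have hs'n : s'.length = iota u x := by omega
    have ht'n : t'.length = iota u y := by omega
    obtain ⟨w', hw', ⟨rfl, rfl⟩ | hlt⟩ := exists_lex_of_mem_unshuffles hp (hsn.trans hs'n.symm)
      (htn.trans ht'n.symm) (hsmin s' ⟨hs'u, hs'n, hs'x⟩) (htmin t' ⟨ht'u, ht'n, ht'y⟩)
    · exact hne rfl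
    · obtain rfl | hlt' := hwmin w' hw'
      · exact irrefl_of (List.Lex WellOrderingRel) _ hlt
      · exact asymm_of (List.Lex WellOrderingRel) hlt hlt'
  rw [iterApp_mul hu w hwu, List.sum_map_eq_nsmul_single (s, t) _ hvanish, nsmul_eq_mul]
  exact mul_ne_zero
    (Nat.cast_ne_zero.2 (@List.count_pos_iff _ instBEqOfDecidableEq _ _ _ |>.2 hw).ne')
    (mul_ne_zero hsx hty)

theorem iota_mul {R : Type*} [CommRing R] [IsDomain R] [CharZero R]
    {u : Set (R → R)} (hu : ∀ D ∈ u, IsDerivation D) (hexh : ∀ x : R, ∃ i : ℕ, x ∈ SocleGNat u i)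
    {x y : R} (hx : x ≠ 0) (hy : y ≠ 0) : iota u (x * y) = iota u x + iota u y := by
  apply le_antisymm
  · refine Nat.sInf_le fun w hw hlen => ?_
    rw [iterApp_mul hu w hw]
    refine List.sum_eq_zero fun z hz => ?_
    obtain ⟨⟨s, t⟩, hp, rfl⟩ := List.mem_map.1 hz
    have hperm := perm_of_mem_unshuffles hp
    have hst : s.length + t.length = iota u x + iota u y + 1 := by
      rw [← List.length_append, hperm.length_eq, hlen]
    obtain hs | ht : iota u x < s.length ∨ iota u y < t.length := by omega
    · simp [iterApp_eq_zero_of_iota_lt hu (hexh x)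
        (fun D hD => hw D (hperm.mem_iff.1 (by simp [hD]))) hs]
    · simp [iterApp_eq_zero_of_iota_lt hu (hexh y)
        (fun D hD => hw D (hperm.mem_iff.1 (by simp [hD]))) ht]
  · obtain ⟨w, hw, hlen, hne⟩ := exists_iterApp_mul_ne_zero hu hexh hx hy
    exact hlen ▸ not_lt.1 fun hlt => hne (iterApp_eq_zero_of_iota_lt hu (hexh _) hw hlt)

/-- If `x * y' = x' * y` with all four elements nonzero, then
`ι x + ι y' = ι x' + ι y`; consequently `-ι x + ι y = -ι x' + ι y'`, so that
`-ι(x) + ι(y)` depends only on the fraction `x / y`. -/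
theorem iota_well_defined {R : Type*} [CommRing R] [IsDomain R] [CharZero R]
    (u : Set (R → R)) (hu : ∀ D ∈ u, IsDerivation D)
    (hexh : ∀ x : R, ∃ i : ℕ, x ∈ SocleGNat u i)
    (x x' y y' : R) (hx : x ≠ 0) (hx' : x' ≠ 0) (hy : y ≠ 0) (hy' : y' ≠ 0)
    (h : x * y' = x' * y) :
    iota u x + iota u y' = iota u x' + iota u y ∧
      -(iota u x : ℤ) + iota u y = -(iota u x' : ℤ) + iota u y' := by
  have key : iota u x + iota u y' = iota u x' + iota u y := by
    rw [← iota_mul hu hexh hx hy', ← iota_mul hu hexh hx' hy, h]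
  exact ⟨key, by omega⟩
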